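/- arXiv:math/0701717 — 2 statements merged into one kernel-verified Lean document; each statement's English description precedes it below -/
import Mathlib

section
/- Let π be a group, G a finite group, α : π → G a group homomorphism, and φ : π → ℤ a group homomorphism that is nontrivial (i.e., φ(g) ≠ 0 for some g ∈ π). Make the group ring ℤ[G × ℤ] into a left π-module by g · x = (α(g), φ(g))·x, and regard its coinvariants ℤ[G × ℤ]_π as a module over the Laurent polynomial ring ℤ[t^{±1}] via the commuting action t · x = (1_G, 1)·x. Then ℤ[G × ℤ]_π is a torsion ℤ[t^{±1}]-module: every element is annihilated by some nonzero Laurent polynomial. -/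
/-- The Laurent polynomial ring `ℤ[t^{±1}]`, realized as the group ring `ℤ[ℤ]`. -/
abbrev Lau : Type := MonoidAlgebra ℤ (Multiplicative ℤ)

/-- The inclusion `ℤ → G × ℤ`, `t ↦ (1_G, t)`. -/
def tEmbedding (G : Type) [Group G] : Multiplicative ℤ →* G × Multiplicative ℤ :=
  MonoidHom.prod 1 (MonoidHom.id _)

/-- The ring homomorphism `ℤ[t^{±1}] = ℤ[ℤ] → ℤ[G × ℤ]` induced by `t ↦ (1_G, t)`. -/
noncomputable def lauHom (G : Type) [Group G] :
    Lau →+* MonoidAlgebra ℤ (G × Multiplicative ℤ) :=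
  MonoidAlgebra.mapDomainRingHom ℤ (tEmbedding G)

/-- `ℤ[G × ℤ]` is a module over `ℤ[t^{±1}]` via (central) multiplication by the image
of `lauHom`; in particular `t • x = (1_G, 1) · x`. -/
noncomputable instance lauModule (G : Type) [Group G] :
    Module Lau (MonoidAlgebra ℤ (G × Multiplicative ℤ)) :=
  Module.compHom _ (lauHom G)

/-- The coinvariants submodule of `ℤ[G × ℤ]` for the left `π`-action
`g • x = (α(g), φ(g)) · x`: the span of the elements `g • m - m`.  (Since the
`ℤ[t^{±1}]`-action is by central multiplication, the `ℤ[t^{±1}]`-span of this set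
coincides with its `ℤ`-span, and taking the span over `ℤ[t^{±1}]` endows the
coinvariants quotient `ℤ[G × ℤ]_π` with its natural `ℤ[t^{±1}]`-module structure,
for which `t • x = (1_G, 1) · x`.) -/
noncomputable def coinvSub {π G : Type} [Group π] [Group G] (α : π →* G)
    (φ : π →* Multiplicative ℤ) :
    Submodule Lau (MonoidAlgebra ℤ (G × Multiplicative ℤ)) :=
  Submodule.span Lau
    {x | ∃ (g : π) (m : MonoidAlgebra ℤ (G × Multiplicative ℤ)),
      x = MonoidAlgebra.single ((α g, φ g) : G × Multiplicative ℤ) (1 : ℤ) * m - m}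

/-- if `G` is finite and `φ : π → ℤ` is nontrivial, then the coinvariants
`ℤ[G × ℤ]_π` form a torsion `ℤ[t^{±1}]`-module: every element is annihilated by some
nonzero Laurent polynomial. -/
theorem statement2 {π G : Type} [Group π] [Group G] [Finite G] (α : π →* G)
    (φ : π →* Multiplicative ℤ) (hφ : ∃ g : π, φ g ≠ 1) :
    ∀ x : (MonoidAlgebra ℤ (G × Multiplicative ℤ)) ⧸ coinvSub α φ,
      ∃ p : Lau, p ≠ 0 ∧ p • x = 0 := by
  obtain ⟨g, hg⟩ := hφ
  have hn : Nat.card G ≠ 0 := Nat.card_pos.ne'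
  have hG : α (g ^ Nat.card G) = 1 := by rw [map_pow, pow_card_eq_one']
  have hne : φ (g ^ Nat.card G) ≠ 1 := by
    rw [map_pow]
    intro h
    apply hg
    have h2 := congrArg Multiplicative.toAdd h
    rw [toAdd_pow, toAdd_one, smul_eq_zero] at h2
    rcases h2 with h2 | h2
    · exact absurd h2 hn
    · exact h2
  intro x
  obtain ⟨m, rfl⟩ := Submodule.Quotient.mk_surjective _ x
  refine ⟨MonoidAlgebra.single (φ (g ^ Nat.card G)) (1 : ℤ) - 1, ?_, ?_⟩
  · intro h
    rw [sub_eq_zero, MonoidAlgebra.one_def] at h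
    exact hne (MonoidAlgebra.single_left_injective one_ne_zero h)
  · rw [← Submodule.Quotient.mk_smul, Submodule.Quotient.mk_eq_zero]
    apply Submodule.subset_span
    refine ⟨g ^ Nat.card G, m, ?_⟩
    rw [sub_smul, one_smul, hG]
    congr 1
    change lauHom G (MonoidAlgebra.single _ 1) * m = _
    congr 1
    simp [lauHom, tEmbedding]
end

section
/- Let π be a group, G a finite group, α : π → G a group homomorphism, and φ : π → ℤ a group homomorphism. Make the group ring ℤ[G × ℤ] into a left π-module by g · x = (α(g), φ(g))·x, and regard its coinvariants ℤ[G × ℤ]_π as a ℤ[t^{±1}]-module via t · x = (1_G, 1)·x. Then ℤ[G × ℤ]_π is a torsion ℤ[t^{±1}]-module if and only if φ is nontrivial (i.e., φ(g) ≠ 0 for some g ∈ π). -/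
/-- for `G` finite, the coinvariants `ℤ[G × ℤ]_π` (with the `π`-action
`g • x = (α(g), φ(g)) · x` and the `ℤ[t^{±1}]`-action `t • x = (1_G, 1) · x`) form a
torsion `ℤ[t^{±1}]`-module if and only if `φ` is nontrivial. -/
theorem statement6 {π G : Type} [Group π] [Group G] [Finite G] (α : π →* G)
    (φ : π →* Multiplicative ℤ) :
    (∀ x : (MonoidAlgebra ℤ (G × Multiplicative ℤ)) ⧸ coinvSub α φ,
        ∃ p : Lau, p ≠ 0 ∧ p • x = 0) ↔ (∃ g : π, φ g ≠ 1) := by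
  have hsmul : ∀ (p : Lau) (m : MonoidAlgebra ℤ (G × Multiplicative ℤ)),
      p • m = lauHom G p * m := fun _ _ => rfl
  constructor
  · intro h
    by_contra! hφ
    obtain ⟨p, hp, hx⟩ := h (Submodule.Quotient.mk 1)
    rw [← Submodule.Quotient.mk_smul, Submodule.Quotient.mk_eq_zero] at hx
    let f : MonoidAlgebra ℤ (G × Multiplicative ℤ) →+* Lau :=
      MonoidAlgebra.mapDomainRingHom ℤ (MonoidHom.snd G (Multiplicative ℤ))
    have hf : ∀ p : Lau, f (lauHom G p) = p := by
      intro p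
      have : f.comp (lauHom G) = RingHom.id Lau := by
        apply MonoidAlgebra.ringHom_ext
        · intro r
          simp [f, lauHom, tEmbedding]
        · intro a
          simp [f, lauHom, tEmbedding]
      exact RingHom.congr_fun this p
    have key : ∀ x ∈ coinvSub α φ, f x = 0 := by
      intro x hx
      unfold coinvSub at hx
      induction hx using Submodule.span_induction with
      | mem x hx =>
        obtain ⟨g, m, rfl⟩ := hx
        have h1 : f (MonoidAlgebra.single ((α g, φ g) : G × Multiplicative ℤ) (1 : ℤ)) = 1 := by
          simp [f, hφ g, MonoidAlgebra.one_def]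
        rw [map_sub, map_mul, h1, one_mul, sub_self]
      | zero => exact map_zero f
      | add x y _ _ hx hy => rw [map_add, hx, hy, add_zero]
      | smul a x _ hx => rw [hsmul, map_mul, hx, mul_zero]
    apply hp
    have := key _ hx
    rwa [hsmul, mul_one, hf] at this
  · rintro ⟨g, hg⟩ x
    obtain ⟨m, rfl⟩ := Submodule.Quotient.mk_surjective _ x
    have hn : Nat.card G ≠ 0 := Nat.card_pos.ne'
    have hα : α (g ^ Nat.card G) = 1 := by rw [map_pow, pow_card_eq_one']
    have hφ : φ (g ^ Nat.card G) ≠ 1 := by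
      rw [map_pow]
      intro h
      apply hg
      have h2 : Nat.card G • Multiplicative.toAdd (φ g) = 0 := congrArg Multiplicative.toAdd h
      have h3 := (smul_eq_zero.mp h2).resolve_left hn
      exact h3
    refine ⟨MonoidAlgebra.single (φ (g ^ Nat.card G)) 1 - 1, ?_, ?_⟩
    · intro h
      rw [sub_eq_zero, MonoidAlgebra.one_def] at h
      exact hφ (MonoidAlgebra.single_left_injective one_ne_zero h)
    · rw [← Submodule.Quotient.mk_smul, Submodule.Quotient.mk_eq_zero]
      apply Submodule.subset_span
      refine ⟨g ^ Nat.card G, m, ?_⟩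
      rw [hsmul, map_sub, map_one, sub_mul, one_mul, hα]
      congr 2
      simp [lauHom, tEmbedding]
end
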